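/- arXiv:2404.15871 — 4 statements merged into one kernel-verified Lean document; each statement's English description precedes it below -/
import Mathlib

section
/- Let (X,d) be a metric space, U ⊆ X, x₀ ∈ int(U), and x, y ∈ X \ {x₀} with x ≠ y. Assume that for every δ > 0 the boundary ∂B_d(x₀,δ) is nonempty. Let γ : I → X be continuous on an interval I ⊆ ℝ with x = γ(t_x), y = γ(t_y), x₀ = γ(t_{x₀}) and such that γ_{x x₀} ∩ γ_{x₀ y} = {x₀}, where γ_{x x₀} and γ_{x₀ y} denote the images of γ over the closed subintervals with endpoints t_x, t_{x₀} and t_{x₀}, t_y respectively. Then there exists δ̃₀ > 0 such that for every δ ∈ (0, δ̃₀], the set γ(I) ∩ ∂B_d(x₀,δ) has cardinality at least 2. -/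
/-- A preconnected set containing the center of a ball and a point outside that ball meets the
frontier of the ball. -/
theorem IsPreconnected.inter_frontier_ball_nonempty {X : Type*} [PseudoMetricSpace X] {S : Set X}
    (hS : IsPreconnected S) {c z : X} (hc : c ∈ S) (hz : z ∈ S) {δ : ℝ} (hδ : 0 < δ)
    (hδz : δ ≤ dist z c) : (S ∩ frontier (Metric.ball c δ)).Nonempty := by
  by_contra h
  have hsub : S ⊆ Metric.ball c δ := by
    refine hS.subset_left_of_subset_union Metric.isOpen_ball isClosed_closure.isOpen_compl
      (Set.disjoint_compl_right_iff_subset.mpr subset_closure) (fun w hw => ?_)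
      ⟨c, hc, Metric.mem_ball_self hδ⟩
    by_contra hw'
    rw [Set.mem_union, not_or, Set.notMem_compl_iff] at hw'
    refine h ⟨w, hw, ?_⟩
    rw [Metric.isOpen_ball.frontier_eq]
    exact ⟨hw'.2, hw'.1⟩
  exact (Metric.mem_ball.mp (hsub hz)).not_ge hδz

/-- If `γ` is continuous on an interval `I`, passes through distinct
`x, y ≠ x₀` and through `x₀ ∈ int U`, the parts of the curve from `x` to `x₀` and from
`x₀` to `y` meet only at `x₀`, and every ball centered at `x₀` has nonempty boundary,
then there is `δ̃₀ > 0` so that for all `δ ∈ (0, δ̃₀]` the set `γ(I) ∩ ∂B(x₀,δ)` has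
at least two elements. -/
theorem stmt_1 {X : Type*} [MetricSpace X] (U : Set X) (x₀ x y : X)
    (hx₀ : x₀ ∈ interior U) (hx : x ≠ x₀) (hy : y ≠ x₀) (hxy : x ≠ y)
    (hbd : ∀ δ > 0, (frontier (Metric.ball x₀ δ)).Nonempty)
    (I : Set ℝ) (hI : I.OrdConnected) (γ : ℝ → X) (hγ : ContinuousOn γ I)
    (tx ty tx₀ : ℝ) (htx : tx ∈ I) (hty : ty ∈ I) (htx₀ : tx₀ ∈ I)
    (hγx : γ tx = x) (hγy : γ ty = y) (hγx₀ : γ tx₀ = x₀)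
    (hmeet : γ '' Set.uIcc tx tx₀ ∩ γ '' Set.uIcc tx₀ ty = {x₀}) :
    ∃ δ₀ > 0, ∀ δ ∈ Set.Ioc 0 δ₀,
      (γ '' I ∩ frontier (Metric.ball x₀ δ)).Nontrivial := by
  have hx₁ : Set.uIcc tx tx₀ ⊆ I := hI.uIcc_subset htx htx₀
  have hy₁ : Set.uIcc tx₀ ty ⊆ I := hI.uIcc_subset htx₀ hty
  refine ⟨min (dist x x₀) (dist y x₀), lt_min (dist_pos.mpr hx) (dist_pos.mpr hy), ?_⟩
  rintro δ ⟨hδ, hδle⟩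
  obtain ⟨p, hp, hpf⟩ :=
    (Set.ordConnected_uIcc.isPreconnected.image γ (hγ.mono hx₁)).inter_frontier_ball_nonempty
      ⟨tx₀, Set.right_mem_uIcc, hγx₀⟩ ⟨tx, Set.left_mem_uIcc, hγx⟩ hδ
      (hδle.trans (min_le_left _ _))
  obtain ⟨q, hq, hqf⟩ :=
    (Set.ordConnected_uIcc.isPreconnected.image γ (hγ.mono hy₁)).inter_frontier_ball_nonempty
      ⟨tx₀, Set.left_mem_uIcc, hγx₀⟩ ⟨ty, Set.right_mem_uIcc, hγy⟩ hδ
      (hδle.trans (min_le_right _ _))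
  refine ⟨p, ⟨Set.image_mono hx₁ hp, hpf⟩, q, ⟨Set.image_mono hy₁ hq, hqf⟩, ?_⟩
  rintro rfl
  obtain rfl : p = x₀ := hmeet.subset ⟨hp, hq⟩
  rw [Metric.isOpen_ball.frontier_eq] at hpf
  exact hpf.2 (Metric.mem_ball_self hδ)
end

section
/- Let (X,d) be a metric space in which, for every x ∈ X and every δ > 0, the boundary ∂B_d(x,δ) of the open ball B_d(x,δ) is a nonempty and path-connected set. Let U be a path-connected subset of X and let x₀ ∈ int(U). Then U \ {x₀} is path-connected. -/
/-- A path starting outside an open set `B` and ending in `B` can be followed, without entering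
`B`, up to a point of the frontier of `B`. -/
theorem JoinedIn.exists_joinedIn_diff_mem_frontier {X : Type*} [TopologicalSpace X] {U B : Set X}
    {x y : X} (h : JoinedIn U x y) (hB : IsOpen B) (hx : x ∉ B) (hy : y ∈ B) :
    ∃ p ∈ frontier B, JoinedIn (U \ B) x p := by
  obtain ⟨γ, hγ⟩ := h
  have hc : Continuous γ.extend := γ.continuous_extend
  have hU (t : ℝ) : γ.extend t ∈ U := hγ _
  have hcross (t : ℝ) (ht0 : 0 ≤ t) (ht : γ.extend t ∈ B) :
      ∃ s ∈ Set.Icc 0 t, γ.extend s ∈ frontier B := by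
    have hpre : IsPreconnected (γ.extend '' Set.Icc 0 t) :=
      isPreconnected_Icc.image _ hc.continuousOn
    by_contra! hno
    have hcl (s : ℝ) (hs : s ∈ Set.Icc 0 t) (hsB : γ.extend s ∉ B) : γ.extend s ∉ closure B :=
      fun hmem ↦ hno s hs (hB.frontier_eq ▸ ⟨hmem, hsB⟩)
    obtain ⟨z, -, hzB, hzc⟩ := hpre B (closure B)ᶜ hB isClosed_closure.isOpen_compl
      (by
        rintro _ ⟨s, hs, rfl⟩
        exact or_iff_not_imp_left.2 (hcl s hs))
      ⟨_, ⟨t, ⟨ht0, le_rfl⟩, rfl⟩, ht⟩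
      ⟨_, ⟨0, ⟨le_rfl, ht0⟩, rfl⟩, hcl 0 ⟨le_rfl, ht0⟩ (by simpa using hx)⟩
    exact hzc (subset_closure hzB)
  have hS : IsCompact (Set.Icc (0 : ℝ) 1 ∩ γ.extend ⁻¹' frontier B) :=
    isCompact_Icc.inter_right (isClosed_frontier.preimage hc)
  obtain ⟨t, ⟨ht, htB⟩, hmin⟩ := hS.exists_isLeast (hcross 1 zero_le_one (by simpa using hy))
  have hnot (s : ℝ) (hs : s ∈ Set.Icc 0 t) : γ.extend s ∉ B := by
    intro hsB
    obtain ⟨u, hu, huB⟩ := hcross s hs.1 hsB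
    have htu : t ≤ u := hmin ⟨⟨hu.1, hu.2.trans (hs.2.trans ht.2)⟩, huB⟩
    have hst : s = t := le_antisymm hs.2 (htu.trans hu.2)
    subst hst
    exact Set.disjoint_right.1 (disjoint_frontier_iff_isOpen.2 hB) hsB htB
  refine ⟨γ.extend t, htB, ?_⟩
  have hpc : IsPathConnected (γ.extend '' Set.Icc 0 t) :=
    ((convex_Icc 0 t).isPathConnected ⟨0, le_rfl, ht.1⟩).image hc
  have hj := (hpc.joinedIn _ ⟨0, ⟨le_rfl, ht.1⟩, rfl⟩ _ ⟨t, ⟨ht.1, le_rfl⟩, rfl⟩).mono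
    (V := U \ B) (by
      rintro _ ⟨s, hs, rfl⟩
      exact ⟨hU s, hnot s hs⟩)
  simpa using hj

/-- In a metric space in which the boundary of every open ball is
nonempty and path-connected, removing a point of the interior of a path-connected
set `U` preserves path-connectedness. -/
theorem stmt_2 {X : Type*} [MetricSpace X]
    (hbd : ∀ (x : X), ∀ δ > 0,
      (frontier (Metric.ball x δ)).Nonempty ∧ IsPathConnected (frontier (Metric.ball x δ)))
    (U : Set X) (hU : IsPathConnected U) (x₀ : X) (hx₀ : x₀ ∈ interior U) :
    IsPathConnected (U \ {x₀}) := by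
  obtain ⟨r, hr, hrU⟩ := Metric.nhds_basis_closedBall.mem_iff.1 (mem_interior_iff_mem_nhds.1 hx₀)
  have hfr (δ : ℝ) (h0 : 0 < δ) (hδ : δ ≤ r) : frontier (Metric.ball x₀ δ) ⊆ U \ {x₀} := by
    intro p hp
    have hps : dist p x₀ = δ := Metric.frontier_ball_subset_sphere hp
    refine ⟨hrU (hps.trans_le hδ), ?_⟩
    rintro rfl
    simp [h0.ne] at hps
  have hout (δ : ℝ) (h0 : 0 < δ) (z : X) (hz : z ∈ U) (hδ : δ ≤ dist z x₀) :
      ∃ p ∈ frontier (Metric.ball x₀ δ), JoinedIn (U \ {x₀}) z p := by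
    obtain ⟨p, hp, hj⟩ :=
      (hU.joinedIn z hz x₀ (interior_subset hx₀)).exists_joinedIn_diff_mem_frontier
        (B := Metric.ball x₀ δ) Metric.isOpen_ball (by simpa using hδ) (Metric.mem_ball_self h0)
    exact ⟨p, hp, hj.mono (Set.sdiff_subset_sdiff_right (by simpa using h0))⟩
  rw [isPathConnected_iff]
  refine ⟨(hbd x₀ r hr).1.mono (hfr r hr le_rfl), fun x hx y hy ↦ ?_⟩
  set δ := min r (min (dist x x₀) (dist y x₀))
  have h0 : 0 < δ := lt_min hr (lt_min (dist_pos.2 hx.2) (dist_pos.2 hy.2))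
  obtain ⟨p, hp, hxp⟩ := hout δ h0 x hx.1 ((min_le_right _ _).trans (min_le_left _ _))
  obtain ⟨q, hq, hyq⟩ := hout δ h0 y hy.1 ((min_le_right _ _).trans (min_le_right _ _))
  exact (hxp.trans (((hbd x₀ δ h0).2.joinedIn p hp q hq).mono (hfr δ h0 (min_le_left _ _)))).trans
    hyq.symm
end

section
/- Let (X,d) be a metric space and U a path-connected subset of X. Let M := {x₁, x₂, …, x_k} be a finite subset of int(U). If for every x ∈ X and every δ > 0 the boundary ∂B_d(x,δ) of the open ball B_d(x,δ) is a nonempty and path-connected set, then the set U \ M is path-connected. -/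
/-- A path that starts outside the closure of an open set `B` and ends in `B` has an initial
segment which avoids `B` and ends on the frontier of `B`. -/
theorem JoinedIn.exists_mem_frontier_joinedIn_diff {X : Type*} [TopologicalSpace X]
    {V B : Set X} {x y : X} (h : JoinedIn V x y) (hB : IsOpen B)
    (hx : x ∉ closure B) (hy : y ∈ B) :
    ∃ z ∈ frontier B, JoinedIn (V \ B) x z := by
  obtain ⟨γ, hγ⟩ := h
  have hc : Continuous γ.extend := γ.continuous_extend
  have hV : ∀ t, γ.extend t ∈ V := fun t => hγ _
  obtain ⟨t₀, ⟨ht₀, htB⟩, hmin⟩ :=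
    (isCompact_Icc.inter_right (isClosed_closure.preimage hc) :
      IsCompact (Set.Icc (0 : ℝ) 1 ∩ γ.extend ⁻¹' closure B)).exists_isLeast
      ⟨1, by simp, by simpa using subset_closure hy⟩
  have hlt : ∀ t ∈ Set.Ico 0 t₀, γ.extend t ∉ closure B := fun t ht hmem =>
    (hmin ⟨⟨ht.1, ht.2.le.trans ht₀.2⟩, hmem⟩).not_gt ht.2
  have hpos : 0 ≠ t₀ := by
    rintro rfl
    exact hx (by simpa using htB)
  have hfr : γ.extend t₀ ∈ frontier B := by
    rw [frontier_eq_closure_inter_closure]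
    refine ⟨htB, map_mem_closure hc (s := Set.Ico 0 t₀) ?_ fun t ht => ?_⟩
    · rw [closure_Ico hpos]
      exact ⟨ht₀.1, le_rfl⟩
    · exact fun hm => hlt t ht (subset_closure hm)
  refine ⟨_, hfr, ?_⟩
  have hpc : IsPathConnected (γ.extend '' Set.Icc 0 t₀) :=
    ((convex_Icc 0 t₀).isPathConnected ⟨0, le_rfl, ht₀.1⟩).image hc
  have hj := hpc.joinedIn _ ⟨0, ⟨le_rfl, ht₀.1⟩, rfl⟩ _ ⟨t₀, ⟨ht₀.1, le_rfl⟩, rfl⟩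
  rw [γ.extend_zero] at hj
  refine hj.mono ?_
  rintro _ ⟨t, ht, rfl⟩
  refine ⟨hV t, fun hm => ?_⟩
  rcases ht.2.eq_or_lt with rfl | h
  · exact (hB.frontier_eq ▸ hfr).2 hm
  · exact hlt t ⟨ht.1, h⟩ (subset_closure hm)

/-- If all small open balls centred at an interior point `m` of a path-connected set `V` have
path-connected frontier, then `V \ {m}` is path-connected. -/
theorem IsPathConnected.diff_singleton_of_frontier_ball {X : Type*} [MetricSpace X] {V : Set X}
    {m : X} (hbd : ∀ δ > 0, IsPathConnected (frontier (Metric.ball m δ)))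
    (hV : IsPathConnected V) (hm : m ∈ interior V) : IsPathConnected (V \ {m}) := by
  obtain ⟨ε, hε, hεV⟩ := Metric.nhds_basis_closedBall.mem_iff.1 (mem_interior_iff_mem_nhds.1 hm)
  have hfr : ∀ δ, 0 < δ → δ ≤ ε → frontier (Metric.ball m δ) ⊆ V \ {m} := by
    refine fun δ hδ hδε z hz => ⟨hεV ?_, ?_⟩
    · exact Metric.closedBall_subset_closedBall hδε
        (Metric.closure_ball_subset_closedBall (frontier_subset_closure hz))
    · rintro rfl
      exact ((Metric.isOpen_ball (x := z) (ε := δ)).frontier_eq ▸ hz).2 (Metric.mem_ball_self hδ)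
  rw [isPathConnected_iff]
  refine ⟨(hbd ε hε).nonempty.mono (hfr ε hε le_rfl), fun x hx y hy => ?_⟩
  have hx0 : 0 < dist x m := dist_pos.2 hx.2
  have hy0 : 0 < dist y m := dist_pos.2 hy.2
  obtain ⟨δ, hδ, hδlt⟩ := exists_between (lt_min hε (lt_min hx0 hy0))
  simp only [lt_min_iff] at hδlt
  have key : ∀ w ∈ V, δ < dist w m →
      ∃ z ∈ frontier (Metric.ball m δ), JoinedIn (V \ {m}) w z := by
    intro w hw hwd
    obtain ⟨z, hz, hj⟩ := (hV.joinedIn w hw m (interior_subset hm)).exists_mem_frontier_joinedIn_diff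
      Metric.isOpen_ball (fun h => hwd.not_ge (Metric.closure_ball_subset_closedBall h))
      (Metric.mem_ball_self hδ)
    exact ⟨z, hz, hj.mono (Set.sdiff_subset_sdiff_right
      (Set.singleton_subset_iff.2 (Metric.mem_ball_self hδ)))⟩
  obtain ⟨a, ha, hxa⟩ := key x hx.1 hδlt.2.1
  obtain ⟨b, hb, hyb⟩ := key y hy.1 hδlt.2.2
  exact (hxa.trans (((hbd δ hδ).joinedIn a ha b hb).mono (hfr δ hδ hδlt.1.le))).trans hyb.symm

/-- In a metric space in which the boundary of every open ball is
nonempty and path-connected, removing a finite subset of the interior of a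
path-connected set `U` preserves path-connectedness. -/
theorem stmt_3 {X : Type*} [MetricSpace X]
    (hbd : ∀ (x : X), ∀ δ > 0,
      (frontier (Metric.ball x δ)).Nonempty ∧ IsPathConnected (frontier (Metric.ball x δ)))
    (U : Set X) (hU : IsPathConnected U)
    (M : Set X) (hMfin : M.Finite) (hM : M ⊆ interior U) :
    IsPathConnected (U \ M) := by
  induction M, hMfin using Set.Finite.induction_on with
  | empty => simpa using hU
  | @insert m S hmS hS ih =>
    rw [Set.insert_subset_iff] at hM
    rw [← Set.union_singleton, ← Set.sdiff_sdiff]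
    refine (ih hM.2).diff_singleton_of_frontier_ball (fun δ hδ => (hbd m δ hδ).2) ?_
    rw [Set.sdiff_eq, interior_inter, hS.isClosed.isOpen_compl.interior_eq]
    exact ⟨hM.1, hmS⟩
end

section
/- Let (X,d) be a metric space and U a path-connected subset of X. Let M ⊆ int(U) be a closed, countably infinite set all of whose points are isolated (iso(M) = M). Assume the (U–M) property holds: for every x̃ ∈ M and every z ∈ M \ {x̃} with d(x̃, z) = dist(x̃, M \ {x̃}), there exist real numbers t_z < t_{x̃} and a continuous map γ* : [t_z, t_{x̃}] → U with γ*(t_z) = z, γ*(t_{x̃}) = x̃ and γ*((t_z, t_{x̃})) ∩ M = ∅. If in addition for every x ∈ X and every δ > 0 the boundary ∂B_d(x,δ) of the open ball B_d(x,δ) is a nonempty and path-connected set, then U \ M is path-connected. -/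
/-- A point of `insert m A` outside an open set `B` that is joined to `m ∈ B` can be joined inside
`A` to a point of the frontier of `B`. -/
theorem JoinedIn.exists_mem_frontier {X : Type*} [TopologicalSpace X] {A B : Set X} {x m : X}
    (h : JoinedIn (insert m A) x m) (hB : IsOpen B) (hx : x ∉ B) (hm : m ∈ B) :
    ∃ p ∈ frontier B, JoinedIn A x p := by
  obtain ⟨γ, hγ⟩ := h
  have hK : IsClosed (γ ⁻¹' closure B) := isClosed_closure.preimage γ.continuous
  obtain ⟨t₀, ht₀, hmin⟩ :=
    hK.isCompact.exists_isLeast ⟨1, subset_closure (by simpa using hm)⟩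
  have hlt : ∀ t < t₀, γ t ∉ B := fun t ht htB => (hmin (subset_closure htB)).not_gt ht
  have ht₀B : γ t₀ ∉ B := by
    intro hB₀
    have hpos : 0 < t₀ := by
      refine lt_of_le_of_ne t₀.2.1 ?_
      rintro rfl
      exact hx (by simpa using hB₀)
    have hev : ∀ᶠ t in nhds t₀, γ t ∈ B := γ.continuous.continuousAt.eventually (hB.mem_nhds hB₀)
    obtain ⟨l, hl, hsub⟩ := exists_Ioc_subset_of_mem_nhds hev ⟨0, hpos⟩
    obtain ⟨t, hlt', htt₀⟩ := exists_between hl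
    exact hlt t htt₀ (hsub ⟨hlt', htt₀.le⟩)
  refine ⟨γ t₀, ⟨ht₀, by rwa [hB.interior_eq]⟩, ?_⟩
  have hA : ∀ t ≤ t₀, γ t ∈ A := by
    intro t ht
    have htB : γ t ∉ B := by
      rcases ht.lt_or_eq with h | rfl
      exacts [hlt t h, ht₀B]
    exact (hγ t).resolve_left fun h => htB (by rwa [h])
  exact ⟨⟨⟨fun s => γ (s * t₀), by fun_prop⟩, by simp, by simp⟩,
    fun s => hA _ unitInterval.mul_le_right⟩

/-- If a neighbourhood `B` of `m` has a path-connected frontier inside `A`, then paths in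
`insert m A` between points outside `B` can be rerouted to avoid `m`. -/
theorem JoinedIn.of_insert {X : Type*} [TopologicalSpace X] {A B : Set X} {x y m : X}
    (h : JoinedIn (insert m A) x y) (hB : IsOpen B) (hx : x ∉ B) (hy : y ∉ B) (hm : m ∈ B)
    (hfr : IsPathConnected (frontier B)) (hfrA : frontier B ⊆ A) : JoinedIn A x y := by
  obtain ⟨γ, hγ⟩ := h
  by_cases hmem : ∃ t, γ t = m
  · obtain ⟨t, rfl⟩ := hmem
    have hpc : IsPathConnected (Set.range γ) := by
      have := isPathConnected_iff_pathConnectedSpace.1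
        ((convex_Icc (0 : ℝ) 1).isPathConnected ⟨0, by simp⟩)
      exact isPathConnected_range γ.continuous
    have hsub : Set.range γ ⊆ insert (γ t) A := Set.range_subset_iff.2 hγ
    have hxm := (hpc.joinedIn x ⟨0, γ.source⟩ (γ t) ⟨t, rfl⟩).mono hsub
    have hym := (hpc.joinedIn y ⟨1, γ.target⟩ (γ t) ⟨t, rfl⟩).mono hsub
    obtain ⟨p, hp, hxp⟩ := hxm.exists_mem_frontier hB hx hm
    obtain ⟨q, hq, hyq⟩ := hym.exists_mem_frontier hB hy hm
    exact (hxp.trans ((hfr.joinedIn p hp q hq).mono hfrA)).trans hyq.symm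
  · exact ⟨γ, fun t => (hγ t).resolve_left fun h => hmem ⟨t, h⟩⟩

/-- Let `U` be path-connected, `M ⊆ int U` closed, countably infinite,
with all of its points isolated. Assume the `(U-M)` property: whenever `xt ∈ M` and
`z ∈ M \ {xt}` realizes `dist(xt, M \ {xt})`, there is a continuous path in `U` from `z`
to `xt` whose interior avoids `M`. If moreover the boundary of every open ball is
nonempty and path-connected, then `U \ M` is path-connected. -/
theorem stmt_4 {X : Type*} [MetricSpace X]
    (U : Set X) (hU : IsPathConnected U)
    (M : Set X) (hMU : M ⊆ interior U) (hMcl : IsClosed M)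
    (hMctble : M.Countable) (hMinf : M.Infinite)
    (hiso : ∀ x ∈ M, ∃ δ > 0, Metric.ball x δ ∩ M = {x})
    (hUM : ∀ xt ∈ M, ∀ z ∈ M \ {xt},
      dist xt z = Metric.infDist xt (M \ {xt}) →
      ∃ (tz txt : ℝ), tz < txt ∧ ∃ γ : ℝ → X,
        ContinuousOn γ (Set.Icc tz txt) ∧ Set.MapsTo γ (Set.Icc tz txt) U ∧
        γ tz = z ∧ γ txt = xt ∧ γ '' Set.Ioo tz txt ∩ M = ∅)
    (hbd : ∀ (x : X), ∀ δ > 0,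
      (frontier (Metric.ball x δ)).Nonempty ∧ IsPathConnected (frontier (Metric.ball x δ))) :
    IsPathConnected (U \ M) := by
  have hfrM : ∀ m ∈ M, ∃ δ > 0, ∀ r, 0 < r → r < δ → frontier (Metric.ball m r) ⊆ U \ M := by
    intro m hm
    obtain ⟨δ, hδ, hδM⟩ := hiso m hm
    obtain ⟨ε, hε, hεU⟩ := Metric.isOpen_iff.1 isOpen_interior m (hMU hm)
    refine ⟨min δ ε, lt_min hδ hε, fun r hr hrδ p hp => ?_⟩
    have hpr : dist p m = r := Metric.frontier_ball_subset_sphere hp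
    refine ⟨interior_subset (hεU ?_), fun hpM => ?_⟩
    · exact hpr.trans_lt (hrδ.trans_le (min_le_right _ _))
    · have hpm : p ∈ Metric.ball m δ ∩ M := ⟨hpr.trans_lt (hrδ.trans_le (min_le_left _ _)), hpM⟩
      rw [hδM, Set.mem_singleton_iff] at hpm
      rw [hpm, dist_self] at hpr
      exact hr.ne hpr
  have hremove : ∀ x ∈ U \ M, ∀ y ∈ U \ M, ∀ F : Set X, F.Finite → F ⊆ M →
      JoinedIn (U \ M ∪ F) x y → JoinedIn (U \ M) x y := by
    intro x hx y hy F hF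
    induction F, hF using Set.Finite.induction_on with
    | empty => intro _ h; simpa using h
    | @insert m F _ _ ih =>
      intro hFM h
      rw [Set.insert_subset_iff] at hFM
      obtain ⟨δ, hδ, hfr⟩ := hfrM m hFM.1
      have hxm : 0 < dist x m := dist_pos.2 fun h => hx.2 (h ▸ hFM.1)
      have hym : 0 < dist y m := dist_pos.2 fun h => hy.2 (h ▸ hFM.1)
      obtain ⟨r, hr, hrlt⟩ := exists_between (lt_min hδ (lt_min hxm hym))
      rw [lt_min_iff, lt_min_iff] at hrlt
      rw [Set.union_insert] at h
      exact ih hFM.2 (h.of_insert Metric.isOpen_ball (fun h => hrlt.2.1.not_gt h)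
        (fun h => hrlt.2.2.not_gt h) (Metric.mem_ball_self hr) (hbd m r hr).2
        ((hfr r hr hrlt.1).trans Set.subset_union_left))
  rw [isPathConnected_iff]
  constructor
  · obtain ⟨m, hm⟩ := hMinf.nonempty
    obtain ⟨δ, hδ, hfr⟩ := hfrM m hm
    exact (hbd m (δ / 2) (half_pos hδ)).1.mono (hfr _ (half_pos hδ) (half_lt_self hδ))
  · intro x hx y hy
    obtain ⟨γ, hγ⟩ := hU.joinedIn x hx.1 y hy.1
    have hfin : (Set.range γ ∩ M).Finite := by
      refine ((isCompact_range γ.continuous).inter_right hMcl).finite ?_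
      refine isDiscrete_iff_forall_mem_exists_isOpen.2 fun m hm => ?_
      obtain ⟨δ, hδ, hδM⟩ := hiso m hm.2
      refine ⟨Metric.ball m δ, Metric.isOpen_ball, Set.Subset.antisymm ?_ ?_⟩
      · exact hδM ▸ Set.inter_subset_inter_right _ Set.inter_subset_right
      · exact Set.singleton_subset_iff.2 ⟨Metric.mem_ball_self hδ, hm⟩
    refine hremove x hx y hy _ hfin Set.inter_subset_right ⟨γ, fun t => ?_⟩
    by_cases ht : γ t ∈ M
    · exact Or.inr ⟨⟨t, rfl⟩, ht⟩
    · exact Or.inl ⟨hγ t, ht⟩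
end
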